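/- arXiv:math/0001130 — 4 statements merged into one kernel-verified Lean document; each statement's English description precedes it below -/
import Mathlib

section
/- The Φ-filtration of a single Kronecker block: Let n ≥ 0. For (λ1,λ2) ∈ ℝ² \ {(0,0)} let P_λ ⊆ ℝ^{2n+1} be the column space of λ1·K1(n) + λ2·K2(n). For an integer i ≥ 1 let Φ_i ⊆ ℝ^{2n+1} be the span of the union, over all i-tuples (λ^(1),…,λ^(i)) of pairwise non-proportional elements of ℝ² \ {(0,0)}, of the subspaces ⋂_{s=1}^{i} P_{λ^(s)}. Then Φ_i = ℝ^{2n+1} for every i with 1 ≤ i ≤ n, and Φ_i equals the span of the first n standard basis vectors of ℝ^{2n+1} for every i ≥ n+1. -/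
open Matrix

noncomputable section

/-- The `n × (n+1)` matrix `B1(n)`: entries `1` on positions `(i, i)`, else `0`. -/
def kronB1 (K : Type*) [Zero K] [One K] (n : ℕ) : Matrix (Fin n) (Fin (n + 1)) K :=
  Matrix.of fun i j => if (j : ℕ) = (i : ℕ) then 1 else 0

/-- The `n × (n+1)` matrix `B2(n)`: entries `1` on positions `(i, i+1)`, else `0`. -/
def kronB2 (K : Type*) [Zero K] [One K] (n : ℕ) : Matrix (Fin n) (Fin (n + 1)) K :=
  Matrix.of fun i j => if (j : ℕ) = (i : ℕ) + 1 then 1 else 0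

/-- The first member `K1(n)` of the Kronecker block pair of dimension `2n+1`. -/
def kronK1 (K : Type*) [Zero K] [One K] [Neg K] (n : ℕ) :
    Matrix (Fin n ⊕ Fin (n + 1)) (Fin n ⊕ Fin (n + 1)) K :=
  Matrix.fromBlocks 0 (kronB1 K n) (-(kronB1 K n)ᵀ) 0

/-- The second member `K2(n)` of the Kronecker block pair of dimension `2n+1`. -/
def kronK2 (K : Type*) [Zero K] [One K] [Neg K] (n : ℕ) :
    Matrix (Fin n ⊕ Fin (n + 1)) (Fin n ⊕ Fin (n + 1)) K :=
  Matrix.fromBlocks 0 (kronB2 K n) (-(kronB2 K n)ᵀ) 0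

/-- The span of the first `n` standard basis vectors ("p-coordinates") of `ℝ^{2n+1}`. -/
def pSpan (n : ℕ) : Submodule ℝ ((Fin n ⊕ Fin (n + 1)) → ℝ) :=
  Submodule.span ℝ (Set.range fun i : Fin n => Pi.single (Sum.inl i : Fin n ⊕ Fin (n + 1)) (1 : ℝ))

/-- `Φ_i` for a single Kronecker block: the span of the union, over all `i`-tuples of pairwise
non-proportional nonzero parameters, of the intersections of the corresponding column spaces. -/
def kronPhi (n i : ℕ) : Submodule ℝ ((Fin n ⊕ Fin (n + 1)) → ℝ) :=
  Submodule.span ℝ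
    (⋃ l ∈ {l : Fin i → ℝ × ℝ | (∀ s, l s ≠ 0) ∧
        ∀ s t, s ≠ t → (l s).1 * (l t).2 - (l s).2 * (l t).1 ≠ 0},
      ((⨅ s, LinearMap.range ((l s).1 • kronK1 ℝ n + (l s).2 • kronK2 ℝ n).mulVecLin :
          Submodule ℝ ((Fin n ⊕ Fin (n + 1)) → ℝ)) : Set ((Fin n ⊕ Fin (n + 1)) → ℝ)))

/-- The matrix `a • B1(n) + b • B2(n)`. -/
def kronPencil (n : ℕ) (a b : ℝ) : Matrix (Fin n) (Fin (n + 1)) ℝ :=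
  a • kronB1 ℝ n + b • kronB2 ℝ n

/-- The vector of degree-`n` monomials in `(-a, b)`; it spans the kernel of `kronPencil n a b`. -/
def kronKer (n : ℕ) (a b : ℝ) : Fin (n + 1) → ℝ :=
  fun j => (-a) ^ (j : ℕ) * b ^ (j.rev : ℕ)

lemma kronPencil_castSucc (n : ℕ) (a b : ℝ) (i k : Fin n) :
    kronPencil n a b i k.castSucc =
      (if k = i then a else 0) + if (k : ℕ) = i + 1 then b else 0 := by
  simp [kronPencil, kronB1, kronB2, Fin.ext_iff]

lemma kronPencil_succ (n : ℕ) (a b : ℝ) (i k : Fin n) :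
    kronPencil n a b i k.succ =
      (if (k : ℕ) + 1 = i then a else 0) + if k = i then b else 0 := by
  simp [kronPencil, kronB1, kronB2, Fin.ext_iff]

lemma kronPencil_mulVec (n : ℕ) (a b : ℝ) (v : Fin (n + 1) → ℝ) (i : Fin n) :
    (kronPencil n a b *ᵥ v) i = a * v i.castSucc + b * v i.succ := by
  have h1 (j : Fin (n + 1)) : (j : ℕ) = i ↔ j = i.castSucc := by simp [Fin.ext_iff]
  have h2 (j : Fin (n + 1)) : (j : ℕ) = i + 1 ↔ j = i.succ := by simp [Fin.ext_iff]
  simp [kronPencil, kronB1, kronB2, mulVec, dotProduct, add_mul, Finset.sum_add_distrib, h1, h2]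

lemma kronPencil_mulVec_kronKer (n : ℕ) (a b : ℝ) :
    kronPencil n a b *ᵥ kronKer n a b = 0 := by
  ext i
  have h : n - (i : ℕ) = n - (i + 1) + 1 := by omega
  simp only [kronPencil_mulVec, kronKer, Fin.val_castSucc, Fin.val_succ, Fin.val_rev,
    Nat.add_sub_add_right, h, Pi.zero_apply]
  ring

lemma kronKer_ne_zero (n : ℕ) {a b : ℝ} (h : (a, b) ≠ 0) : kronKer n a b ≠ 0 := by
  intro h0
  have hb := congrFun h0 0
  have ha := congrFun h0 (Fin.last n)
  simp only [kronKer, Fin.val_zero, pow_zero, one_mul, Fin.rev_zero, Fin.val_last, Fin.rev_last,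
    mul_one, Pi.zero_apply] at ha hb
  exact h (Prod.ext (neg_eq_zero.1 (eq_zero_of_pow_eq_zero ha)) (eq_zero_of_pow_eq_zero hb))

lemma kronPencil_transpose_injective (n : ℕ) {a b : ℝ} (h : (a, b) ≠ 0) :
    Function.Injective (kronPencil n a b)ᵀ.mulVecLin := by
  rw [← LinearMap.ker_eq_bot, LinearMap.ker_eq_bot']
  intro x hx
  have hx' (j : Fin (n + 1)) : ∑ i, kronPencil n a b i j * x i = 0 := congrFun hx j
  by_cases ha : a = 0
  · have hb : b ≠ 0 := fun hb => h (by simp [ha, hb])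
    ext k
    simpa [kronPencil_succ, ha, hb] using hx' k.succ
  · suffices H : ∀ m (hm : m < n), x ⟨m, hm⟩ = 0 from funext fun k => H k k.2
    intro m
    induction m with
    | zero =>
      intro hm
      have h0 := hx' (Fin.castSucc ⟨0, hm⟩)
      simp only [kronPencil_castSucc] at h0
      simpa [ha] using h0
    | succ m ih =>
      intro hm
      have h1 (i : Fin n) : m = i ↔ (⟨m, by omega⟩ : Fin n) = i := by simp [Fin.ext_iff]
      have h0 := hx' (Fin.castSucc ⟨m + 1, hm⟩)
      simp only [kronPencil_castSucc] at h0
      simpa [ha, add_mul, Finset.sum_add_distrib, h1, ih (by omega)] using h0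

lemma rank_kronPencil (n : ℕ) {a b : ℝ} (h : (a, b) ≠ 0) : (kronPencil n a b).rank = n := by
  rw [← rank_transpose, Matrix.rank,
    LinearMap.finrank_range_of_inj (kronPencil_transpose_injective n h)]
  simp

lemma kronPencil_mulVec_surjective (n : ℕ) {a b : ℝ} (h : (a, b) ≠ 0) :
    Function.Surjective (kronPencil n a b).mulVecLin := by
  rw [← LinearMap.range_eq_top]
  apply Submodule.eq_top_of_finrank_eq
  simpa [Matrix.rank] using rank_kronPencil n h

lemma range_kronPencil_transpose (n : ℕ) {a b : ℝ} (h : (a, b) ≠ 0) :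
    LinearMap.range (kronPencil n a b)ᵀ.mulVecLin =
      LinearMap.ker (dotProductBilin ℝ ℝ (kronKer n a b)) := by
  apply Submodule.eq_of_le_of_finrank_eq
  · rintro _ ⟨x, rfl⟩
    rw [LinearMap.mem_ker, dotProductBilin_apply_apply, mulVecLin_apply, dotProduct_mulVec,
      vecMul_transpose, kronPencil_mulVec_kronKer, zero_dotProduct]
  · have hne : dotProductBilin ℝ ℝ (kronKer n a b) ≠ 0 := fun h0 =>
      kronKer_ne_zero n h (dotProduct_self_eq_zero.1 (LinearMap.congr_fun h0 _))
    have h1 := Module.Dual.finrank_ker_add_one_of_ne_zero hne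
    have h2 := rank_kronPencil n h
    rw [← rank_transpose, Matrix.rank] at h2
    simp only [Module.finrank_fintype_fun_eq_card, Fintype.card_fin] at h1
    omega

lemma mem_range_kron_iff (n : ℕ) {l : ℝ × ℝ} (h : l ≠ 0) (v : Fin n ⊕ Fin (n + 1) → ℝ) :
    v ∈ LinearMap.range (l.1 • kronK1 ℝ n + l.2 • kronK2 ℝ n).mulVecLin ↔
      kronKer n l.1 l.2 ⬝ᵥ (v ∘ Sum.inr) = 0 := by
  have hK : l.1 • kronK1 ℝ n + l.2 • kronK2 ℝ n =
      fromBlocks 0 (kronPencil n l.1 l.2) (-(kronPencil n l.1 l.2)ᵀ) 0 := by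
    simp only [kronK1, kronK2, kronPencil, fromBlocks_smul, fromBlocks_add]
    simp [add_comm]
  have hr : v ∘ Sum.inr ∈ LinearMap.range (kronPencil n l.1 l.2)ᵀ.mulVecLin ↔
      kronKer n l.1 l.2 ⬝ᵥ (v ∘ Sum.inr) = 0 := by
    rw [range_kronPencil_transpose n h]
    rfl
  rw [hK, ← hr]
  constructor
  · rintro ⟨x, rfl⟩
    refine ⟨-(x ∘ Sum.inl), ?_⟩
    ext j
    simp [fromBlocks_mulVec, neg_mulVec, mulVec_transpose]
  · rintro ⟨x, hx⟩
    obtain ⟨y, hy⟩ := kronPencil_mulVec_surjective n h (v ∘ Sum.inl)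
    refine ⟨Sum.elim (-x) y, ?_⟩
    simp only [mulVecLin_apply] at hx hy
    ext (j | j) <;> simp [fromBlocks_mulVec, mulVec_neg, neg_mulVec, hx, hy]

/-- The Vandermonde matrix with rows `kronKer`, evaluated at a family of parameters. -/
def kronVandermonde (n : ℕ) (l : Fin (n + 1) → ℝ × ℝ) : Matrix (Fin (n + 1)) (Fin (n + 1)) ℝ :=
  projVandermonde (fun s => -(l s).1) (fun s => (l s).2)

lemma kronVandermonde_mulVec (n : ℕ) (l : Fin (n + 1) → ℝ × ℝ) (q : Fin (n + 1) → ℝ)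
    (s : Fin (n + 1)) :
    (kronVandermonde n l *ᵥ q) s = kronKer n (l s).1 (l s).2 ⬝ᵥ q := rfl

lemma det_kronVandermonde_ne_zero (n : ℕ) {l : Fin (n + 1) → ℝ × ℝ}
    (h : ∀ s t, s ≠ t → (l s).1 * (l t).2 - (l s).2 * (l t).1 ≠ 0) :
    (kronVandermonde n l).det ≠ 0 := by
  rw [kronVandermonde, det_projVandermonde]
  refine Finset.prod_ne_zero_iff.2 fun s _ => Finset.prod_ne_zero_iff.2 fun t ht => ?_
  have := h s t (Finset.mem_Ioi.1 ht).ne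
  contrapose! this
  linarith

/-- A standard family of pairwise non-proportional parameters. -/
def kronParam (k : ℕ) : ℝ × ℝ := (k, 1)

lemma kronParam_ne_zero (k : ℕ) : kronParam k ≠ 0 := by
  simp [kronParam, Prod.ext_iff]

lemma kronParam_det_ne_zero {k m : ℕ} (h : k ≠ m) :
    (kronParam k).1 * (kronParam m).2 - (kronParam k).2 * (kronParam m).1 ≠ 0 := by
  simpa [kronParam, sub_eq_zero] using h

lemma mem_kronPhi {n i : ℕ} {v : Fin n ⊕ Fin (n + 1) → ℝ} (f : Fin i → ℕ)
    (hf : Function.Injective f)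
    (hv : ∀ s, kronKer n (kronParam (f s)).1 (kronParam (f s)).2 ⬝ᵥ (v ∘ Sum.inr) = 0) :
    v ∈ kronPhi n i := by
  refine Submodule.subset_span (Set.mem_iUnion₂.2 ⟨fun s => kronParam (f s),
    ⟨fun s => kronParam_ne_zero _, fun s t hst => kronParam_det_ne_zero (hf.ne hst)⟩, ?_⟩)
  rw [SetLike.mem_coe, Submodule.mem_iInf]
  exact fun s => (mem_range_kron_iff n (kronParam_ne_zero _) v).2 (hv s)

lemma mem_kronPhi_of_inr_eq_zero {n : ℕ} (i : ℕ) {v : Fin n ⊕ Fin (n + 1) → ℝ}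
    (hv : v ∘ Sum.inr = 0) : v ∈ kronPhi n i :=
  mem_kronPhi (fun s => s) Fin.val_injective fun s => by rw [hv, dotProduct_zero]

lemma mem_pSpan_of_inr_eq_zero {n : ℕ} {v : Fin n ⊕ Fin (n + 1) → ℝ}
    (hv : v ∘ Sum.inr = 0) : v ∈ pSpan n := by
  have hv' (j : Fin (n + 1)) : v (Sum.inr j) = 0 := congrFun hv j
  rw [pi_eq_sum_univ' v, Fintype.sum_sum_type]
  simp only [hv', zero_smul, Finset.sum_const_zero, add_zero]
  refine Submodule.sum_mem _ fun k _ => Submodule.smul_mem _ _ (Submodule.subset_span ⟨k, ?_⟩)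
  ext x
  simp [Pi.single_apply]

lemma kronPhi_eq_top {n i : ℕ} (hi : i ≤ n) : kronPhi n i = ⊤ := by
  refine eq_top_iff.2 fun v _ => ?_
  set V := kronVandermonde n fun s => kronParam s
  have hdet : IsUnit V.det := (det_kronVandermonde_ne_zero n fun s t hst =>
    kronParam_det_ne_zero (Fin.val_injective.ne hst)).isUnit
  have hdual (k s : Fin (n + 1)) :
      kronKer n (kronParam s).1 (kronParam s).2 ⬝ᵥ V⁻¹.col k = (1 : Matrix _ _ ℝ) s k := by
    rw [← mul_nonsing_inv V hdet]
    rfl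
  have hsum : v = Sum.elim (v ∘ Sum.inl) 0 +
      ∑ k, (V *ᵥ (v ∘ Sum.inr)) k • (Sum.elim 0 (V⁻¹.col k) : Fin n ⊕ Fin (n + 1) → ℝ) := by
    have hq : v ∘ Sum.inr = V⁻¹ *ᵥ (V *ᵥ (v ∘ Sum.inr)) := by
      rw [mulVec_mulVec, nonsing_inv_mul V hdet, one_mulVec]
    ext (j | j)
    · simp
    · have := congrFun hq j
      rw [Function.comp_apply] at this
      rw [this]
      simp [mulVec, dotProduct, mul_comm]
  rw [hsum]
  refine add_mem (mem_kronPhi_of_inr_eq_zero i rfl)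
    (sum_mem fun k _ => Submodule.smul_mem _ _ ?_)
  refine mem_kronPhi (fun s => k.succAbove (Fin.castLE hi s))
    (Fin.val_injective.comp (Fin.succAbove_right_injective.comp (Fin.castLE_injective hi)))
    fun s => ?_
  rw [Sum.elim_comp_inr, hdual, one_apply_ne (Fin.succAbove_ne _ _)]

lemma kronPhi_eq_pSpan {n i : ℕ} (hi : n + 1 ≤ i) : kronPhi n i = pSpan n := by
  apply le_antisymm
  · refine Submodule.span_le.2 (Set.iUnion₂_subset fun l hl v hv => ?_)
    rw [SetLike.mem_coe, Submodule.mem_iInf] at hv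
    refine mem_pSpan_of_inr_eq_zero (eq_zero_of_mulVec_eq_zero
      (det_kronVandermonde_ne_zero n (l := fun s => l (Fin.castLE hi s)) fun s t hst =>
        hl.2 _ _ ((Fin.castLE_injective hi).ne hst)) ?_)
    ext s
    exact (mem_range_kron_iff n (hl.1 _) v).1 (hv _)
  · refine Submodule.span_le.2 ?_
    rintro _ ⟨k, rfl⟩
    refine mem_kronPhi_of_inr_eq_zero i ?_
    ext j
    simp

/-- the Φ-filtration of a single Kronecker block: `Φ_i = ℝ^{2n+1}` for
`1 ≤ i ≤ n` and `Φ_i` is the p-coordinate subspace for `i ≥ n+1`. -/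
theorem kronecker_phi_filtration (n : ℕ) :
    (∀ i, 1 ≤ i → i ≤ n → kronPhi n i = ⊤) ∧
    (∀ i, n + 1 ≤ i → kronPhi n i = pSpan n) :=
  ⟨fun _ _ hi => kronPhi_eq_top hi, fun _ hi => kronPhi_eq_pSpan hi⟩

end
end

section
/- Pointwise form of Brailov's completeness criterion (Proposition 1.7 and Theorem 1.8 of the paper): Let C1, C2 be real skew-symmetric N×N matrices and let R0 be the maximum over (λ1,λ2) ∈ ℝ² of rank(λ1·C1 + λ2·C2). Then the following are equivalent: (a) for every (λ1,λ2) ∈ ℂ² \ {(0,0)}, the complex matrix λ1·C1 + λ2·C2 has rank R0; (b) the intersection of the column spaces of λ1·C1 + λ2·C2, taken over all (λ1,λ2) ∈ ℝ² with rank(λ1·C1 + λ2·C2) = R0, has real dimension R0/2. -/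
open Matrix

noncomputable section

open Module

section LinearPencil

variable {K V E : Type*} [Field K] [AddCommGroup V] [Module K V]
  [AddCommGroup E] [Module K E] [FiniteDimensional K E]

/-- Injectivity is a Zariski-open condition along a line of linear maps. -/
theorem finite_setOf_ker_add_smul_ne_bot (f h : E →ₗ[K] V) (hf : LinearMap.ker f = ⊥) :
    {s : K | LinearMap.ker (f + s • h) ≠ ⊥}.Finite := by
  obtain ⟨g, hg⟩ := f.exists_leftInverse_of_injective hf
  have hfin : Set.Finite {μ : K | End.HasEigenvalue (g ∘ₗ h) μ} :=
    End.finite_hasEigenvalue _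
  refine (hfin.image fun μ => -μ⁻¹).subset fun s hs => ?_
  obtain ⟨x, hx, hx0⟩ := (Submodule.ne_bot_iff _).1 hs
  have hgx : g (f x) = x := LinearMap.congr_fun hg x
  have hx' : x + s • g (h x) = 0 := by
    have := congrArg g (LinearMap.mem_ker.1 hx)
    simpa [hgx] using this
  have hs0 : s ≠ 0 := by
    rintro rfl
    simp [hx0] at hx'
  refine ⟨-s⁻¹, End.hasEigenvalue_of_hasEigenvector (x := x) ⟨?_, hx0⟩, by simp⟩
  have hx'' : x = -(s • g (h x)) := eq_neg_of_add_eq_zero_left hx'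
  rw [End.mem_eigenspace_iff, LinearMap.comp_apply]
  nth_rw 2 [hx'']
  simp [smul_smul, hs0]

/-- The rank does not drop except at finitely many points of a line of linear maps. -/
theorem finite_setOf_finrank_range_add_smul_lt (M D : E →ₗ[K] V) :
    {s : K | finrank K (LinearMap.range (M + s • D)) < finrank K (LinearMap.range M)}.Finite := by
  obtain ⟨q, hq⟩ := M.rangeRestrict.exists_rightInverse_of_surjective M.range_rangeRestrict
  have hMq : M ∘ₗ q = (LinearMap.range M).subtype := by
    ext y
    exact congrArg Subtype.val (LinearMap.congr_fun hq y)
  refine (finite_setOf_ker_add_smul_ne_bot (M ∘ₗ q) (D ∘ₗ q) (by simp [hMq])).subset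
    fun s hs hker => (Set.mem_ofPred_eq ▸ hs).not_ge ?_
  have hcomp : M ∘ₗ q + s • D ∘ₗ q = (M + s • D) ∘ₗ q := by ext; simp
  rw [← LinearMap.finrank_range_of_inj (LinearMap.ker_eq_bot.1 hker), hcomp]
  exact Submodule.finrank_mono (LinearMap.range_comp_le_range _ _)

/-- A vector in the range of infinitely many members of a line of linear maps lies in the range of
every member of at least their rank. -/
theorem mem_range_of_infinite [FiniteDimensional K V] (M D : V →ₗ[K] V) (w : V) {S : Set K}
    (hS : S.Infinite)
    (hw : ∀ s ∈ S, w ∈ LinearMap.range (M + s • D))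
    (hr : ∀ s ∈ S, finrank K (LinearMap.range (M + s • D)) ≤ finrank K (LinearMap.range M)) :
    w ∈ LinearMap.range M := by
  let M' : V × K →ₗ[K] V := M.coprod (LinearMap.toSpanSingleton K V w)
  let D' : V × K →ₗ[K] V := D.coprod 0
  have hrange : ∀ N : V →ₗ[K] V, LinearMap.range (N.coprod (LinearMap.toSpanSingleton K V w)) =
      LinearMap.range N ⊔ Submodule.span K {w} := fun N => by
    rw [LinearMap.range_coprod, LinearMap.range_toSpanSingleton]
  obtain ⟨s, hsS, hs⟩ := hS.exists_notMem_finite (finite_setOf_finrank_range_add_smul_lt M' D')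
  have hadd : M' + s • D' = (M + s • D).coprod (LinearMap.toSpanSingleton K V w) := by
    ext <;> simp [M', D']
  have hle : Submodule.span K {w} ≤ LinearMap.range (M + s • D) := by simpa using hw s hsS
  rw [Set.mem_ofPred_eq, not_lt, hadd, hrange, hrange, sup_eq_left.2 hle] at hs
  have := Submodule.eq_of_le_of_finrank_le (S₁ := LinearMap.range M)
    (S₂ := LinearMap.range M ⊔ Submodule.span K {w}) le_sup_left (hs.trans (hr s hsS))
  rw [this]
  exact Submodule.mem_sup_right (Submodule.mem_span_singleton_self w)

/-- The common range of the members `A - t • B`, `t ∈ S`, is contained in the range of `B`. -/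
theorem iInf_range_sub_smul_le [FiniteDimensional K V] (A B : V →ₗ[K] V) {S : Set K}
    (hS : S.Infinite)
    (hr : ∀ t ∈ S, finrank K (LinearMap.range (A - t • B)) ≤ finrank K (LinearMap.range B)) :
    ⨅ t ∈ S, LinearMap.range (A - t • B) ≤ LinearMap.range B := by
  intro w hw
  simp only [Submodule.mem_iInf] at hw
  have hrange : ∀ t : K, t ≠ 0 →
      LinearMap.range (B + (-t⁻¹) • A) = LinearMap.range (A - t • B) := fun t ht => by
    have : B + (-t⁻¹) • A = (-t⁻¹) • (A - t • B) := by
      rw [smul_sub, smul_smul]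
      simp [ht, add_comm]
    rw [this, LinearMap.range_smul _ _ (by simpa using ht)]
  have hS' : ((fun t : K => -t⁻¹) '' (S \ {0})).Infinite :=
    (hS.sdiff (Set.finite_singleton 0)).image (by intro x _ y _ h; simpa using h)
  refine mem_range_of_infinite B A w hS' ?_ ?_
  · rintro _ ⟨t, ⟨ht, ht0⟩, rfl⟩
    rw [hrange t ht0]
    exact hw t ht
  · rintro _ ⟨t, ⟨ht, ht0⟩, rfl⟩
    rw [hrange t ht0]
    exact hr t ht

end LinearPencil

section SkewPencil

variable {K V : Type*} [Field K] [AddCommGroup V] [Module K V]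
  {β : LinearMap.BilinForm K V} {A B : V →ₗ[K] V} {S : Set K} {r : ℕ}

theorem skew_sub_smul (hA : ∀ x y, β (A x) y = -β x (A y)) (hB : ∀ x y, β (B x) y = -β x (B y))
    (t : K) (x y : V) : β ((A - t • B) x) y = -β x ((A - t • B) y) := by
  simp [hA, hB]
  ring

theorem map_iSup_ker_le_map (τ : K) :
    (⨆ t ∈ S, LinearMap.ker (A - t • B)).map (A - τ • B) ≤
      (⨆ t ∈ S, LinearMap.ker (A - t • B)).map B := by
  rw [Submodule.map_le_iff_le_comap]
  refine iSup₂_le fun t ht x hx => ?_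
  have hAx : A x = t • B x := by simpa [sub_eq_zero] using hx
  have hx' : x ∈ ⨆ t ∈ S, LinearMap.ker (A - t • B) :=
    Submodule.mem_iSup_of_mem t (Submodule.mem_iSup_of_mem ht hx)
  refine ⟨(t - τ) • x, Submodule.smul_mem _ _ hx', ?_⟩
  simp [hAx, sub_smul]

theorem map_iSup_ker_eq_map {τ : K} (hτ : τ ∉ S) :
    (⨆ t ∈ S, LinearMap.ker (A - t • B)).map (A - τ • B) =
      (⨆ t ∈ S, LinearMap.ker (A - t • B)).map B := by
  refine (map_iSup_ker_le_map τ).antisymm ?_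
  rw [Submodule.map_le_iff_le_comap]
  refine iSup₂_le fun t ht x hx => ?_
  have hAx : A x = t • B x := by simpa [sub_eq_zero] using hx
  have htτ : t - τ ≠ 0 := sub_ne_zero.2 (by rintro rfl; exact hτ ht)
  have hx' : x ∈ ⨆ t ∈ S, LinearMap.ker (A - t • B) :=
    Submodule.mem_iSup_of_mem t (Submodule.mem_iSup_of_mem ht hx)
  refine ⟨(t - τ)⁻¹ • x, Submodule.smul_mem _ _ hx', ?_⟩
  have : (A - τ • B) x = (t - τ) • B x := by simp [hAx, sub_smul]
  rw [map_smul, this, smul_smul, inv_mul_cancel₀ htτ, one_smul]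

variable [FiniteDimensional K V]

theorem range_eq_orthogonal_ker (hβ : β.Nondegenerate) {M : V →ₗ[K] V}
    (hM : ∀ x y, β (M x) y = -β x (M y)) :
    LinearMap.range M = β.orthogonal (LinearMap.ker M) := by
  refine Submodule.eq_of_le_of_finrank_eq ?_ ?_
  · rintro _ ⟨x, rfl⟩
    rw [LinearMap.BilinForm.mem_orthogonal_iff]
    intro n hn
    simpa [LinearMap.mem_ker.1 hn] using hM n x
  · have := M.finrank_range_add_finrank_ker
    rw [LinearMap.BilinForm.finrank_orthogonal hβ]
    omega

theorem finrank_map_add_finrank_ker {M : V →ₗ[K] V} {L : Submodule K V}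
    (h : LinearMap.ker M ≤ L) :
    finrank K (L.map M) + finrank K (LinearMap.ker M) = finrank K L := by
  have := (M.domRestrict L).finrank_range_add_finrank_ker
  rw [LinearMap.range_domRestrict, LinearMap.ker_domRestrict,
    (Submodule.comapSubtypeEquivOfLe h).finrank_eq] at this
  exact this

theorem finrank_le_finrank_map_add_finrank_ker (M : V →ₗ[K] V) (L : Submodule K V) :
    finrank K L ≤ finrank K (L.map M) + finrank K (LinearMap.ker M) := by
  have := (M.domRestrict L).finrank_range_add_finrank_ker
  rw [LinearMap.range_domRestrict, LinearMap.ker_domRestrict] at this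
  have hle : finrank K ((LinearMap.ker M).comap L.subtype) ≤ finrank K (LinearMap.ker M) := by
    rw [← LinearMap.finrank_range_of_inj (f := L.subtype ∘ₗ ((LinearMap.ker M).comap
      L.subtype).subtype) (L.injective_subtype.comp (Submodule.injective_subtype _))]
    refine Submodule.finrank_mono ?_
    rintro _ ⟨x, rfl⟩
    exact x.2
  omega

/-- If a skew map `M` sends the orthogonal complement of `W` onto `W`, its rank is `2 dim W`. -/
theorem finrank_range_of_map_orthogonal (hβ : β.Nondegenerate) (hrefl : β.IsRefl)
    {M : V →ₗ[K] V} (hM : ∀ x y, β (M x) y = -β x (M y)) {W : Submodule K V}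
    (hW : (β.orthogonal W).map M = W) :
    finrank K (LinearMap.range M) = 2 * finrank K W := by
  have hle : W ≤ LinearMap.range M := hW ▸ LinearMap.map_le_range
  have hker : LinearMap.ker M ≤ β.orthogonal W := by
    have := LinearMap.BilinForm.orthogonal_le (B := β) hle
    rwa [range_eq_orthogonal_ker hβ hM,
      LinearMap.BilinForm.orthogonal_orthogonal hβ hrefl] at this
  have h1 := finrank_map_add_finrank_ker hker
  rw [hW, LinearMap.BilinForm.finrank_orthogonal hβ] at h1
  have h2 := M.finrank_range_add_finrank_ker
  have h3 := Submodule.finrank_le W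
  omega

theorem orthogonal_iInf_range (hβ : β.Nondegenerate) (hrefl : β.IsRefl)
    (hA : ∀ x y, β (A x) y = -β x (A y)) (hB : ∀ x y, β (B x) y = -β x (B y)) :
    β.orthogonal (⨅ t ∈ S, LinearMap.range (A - t • B)) =
      ⨆ t ∈ S, LinearMap.ker (A - t • B) := by
  have hM := skew_sub_smul hA hB
  rw [← LinearMap.BilinForm.orthogonal_orthogonal hβ hrefl
    (⨆ t ∈ S, LinearMap.ker (A - t • B))]
  congr 1
  apply le_antisymm
  · intro w hw
    rw [LinearMap.BilinForm.mem_orthogonal_iff]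
    intro n hn
    apply hrefl
    have : (⨆ t ∈ S, LinearMap.ker (A - t • B)) ≤ LinearMap.ker (β w) := by
      refine iSup₂_le fun t ht x hx => hrefl _ _ ?_
      simp only [Submodule.mem_iInf] at hw
      have := hw t ht
      rw [range_eq_orthogonal_ker hβ (hM t)] at this
      exact this x hx
    exact this hn
  · refine le_iInf₂ fun t ht => ?_
    rw [range_eq_orthogonal_ker hβ (hM t)]
    exact LinearMap.BilinForm.orthogonal_le
      (le_iSup₂ (f := fun t (_ : t ∈ S) => LinearMap.ker (A - t • B)) t ht)

/-- The span of the kernels of the regular members of a skew pencil is isotropic. -/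
theorem map_iSup_ker_le_iInf_range (hβ : β.Nondegenerate)
    (hA : ∀ x y, β (A x) y = -β x (A y)) (hB : ∀ x y, β (B x) y = -β x (B y))
    (hS : S.Infinite) (hSr : ∀ t ∈ S, finrank K (LinearMap.range (A - t • B)) = r) :
    (⨆ t ∈ S, LinearMap.ker (A - t • B)).map B ≤ ⨅ t ∈ S, LinearMap.range (A - t • B) := by
  have hM := skew_sub_smul hA hB
  rw [Submodule.map_le_iff_le_comap]
  refine iSup₂_le fun t ht x hx => ?_
  have hAx : A x = t • B x := by simpa [sub_eq_zero] using hx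
  have hne : ∀ s ∈ S, s ≠ t → B x ∈ LinearMap.range (A - s • B) := fun s hs hst => by
    rw [range_eq_orthogonal_ker hβ (hM s), LinearMap.BilinForm.mem_orthogonal_iff]
    intro y hy
    have hAy : A y = s • B y := by simpa [sub_eq_zero] using hy
    have h1 := hA y x
    rw [hAx, hAy] at h1
    simp only [map_smul, LinearMap.smul_apply, smul_eq_mul, hB] at h1
    have h2 : (s - t) * β y (B x) = 0 := by linear_combination -h1
    exact (mul_eq_zero.1 h2).resolve_left (sub_ne_zero.2 hst)
  simp only [Submodule.mem_comap, Submodule.mem_iInf]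
  intro s hs
  rcases eq_or_ne s t with rfl | hst
  · have hadd : ∀ u, A - s • B + (s - u) • B = A - u • B := fun u => by
      rw [sub_smul]; abel
    have hS' : ((fun u : K => s - u) '' (S \ {s})).Infinite :=
      (hS.sdiff (Set.finite_singleton s)).image (by intro x _ y _ h; simpa using h)
    refine mem_range_of_infinite _ B _ hS' ?_ ?_
    · rintro _ ⟨u, ⟨hu, hus⟩, rfl⟩
      rw [hadd]
      exact hne u hu hus
    · rintro _ ⟨u, ⟨hu, hus⟩, rfl⟩
      rw [hadd, hSr u hu, hSr s hs]
  · exact hne s hs hst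

/-- Over an algebraically closed field, the operator induced by `A ∘ B⁻¹` on a nontrivial quotient
`W / B L` has an eigenvector, which lifts to some `x ∉ L` with `A x - τ B x ∈ B L`. -/
theorem exists_sub_smul_mem_map [IsAlgClosed K] {L W : Submodule K V}
    (hWB : W ≤ LinearMap.range B) (hker : LinearMap.ker B ≤ L) (hBL : L.map B < W)
    (hAL : L.map A ≤ L.map B) (hAW : (W.comap B).map A ≤ W) :
    ∃ (τ : K) (x : V), x ∉ L ∧ (A - τ • B) x ∈ L.map B := by
  obtain ⟨q, hq⟩ := (B.domRestrict (W.comap B)).rangeRestrict.exists_rightInverse_of_surjective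
    (LinearMap.range_rangeRestrict _)
  have hrange : LinearMap.range (B.domRestrict (W.comap B)) = W := by
    rw [LinearMap.range_domRestrict, Submodule.map_comap_eq, inf_eq_right.2 hWB]
  let σ : W →ₗ[K] V := (W.comap B).subtype ∘ₗ q ∘ₗ Submodule.inclusion hrange.ge
  have hσ : ∀ w : W, B (σ w) = w := fun w =>
    congrArg Subtype.val (LinearMap.congr_fun hq (Submodule.inclusion hrange.ge w))
  let T : End K W := (A ∘ₗ σ).codRestrict W fun w =>
    hAW ⟨σ w, by simp [hσ], rfl⟩
  let P : Submodule K W := (L.map B).comap W.subtype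
  have hσL : ∀ w : W, (w : V) ∈ L.map B → σ w ∈ L := by
    rintro w ⟨l, hl, hlw⟩
    have h0 : σ w - l ∈ L := hker (by simp [hσ, hlw])
    simpa using L.add_mem h0 hl
  have hTP : P ≤ P.comap T := fun w hw => hAL ⟨σ w, hσL w hw, rfl⟩
  have hP : P ≠ ⊤ := fun h => hBL.not_ge (Submodule.comap_subtype_eq_top.1 h)
  have : Nontrivial (W ⧸ P) := Submodule.Quotient.nontrivial_iff.2 hP
  obtain ⟨τ, hτ⟩ := End.exists_eigenvalue (P.mapQ P T hTP)
  obtain ⟨v, hv⟩ := hτ.exists_hasEigenvector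
  obtain ⟨w, rfl⟩ := P.mkQ_surjective v
  refine ⟨τ, σ w, fun hw => hv.2 ?_, ?_⟩
  · rw [Submodule.mkQ_apply, Submodule.Quotient.mk_eq_zero]
    exact ⟨σ w, hw, hσ w⟩
  · have h := hv.apply_eq_smul
    rw [Submodule.mkQ_apply, Submodule.mapQ_apply, ← Submodule.Quotient.mk_smul,
      Submodule.Quotient.eq] at h
    simpa [P, T, hσ] using h

/-- Kronecker-type criterion for a skew pencil `A - t • B` over an algebraically closed field. -/
theorem skew_pencil_criterion [IsAlgClosed K] (hβ : β.Nondegenerate) (hrefl : β.IsRefl)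
    (hA : ∀ x y, β (A x) y = -β x (A y)) (hB : ∀ x y, β (B x) y = -β x (B y))
    (hBr : finrank K (LinearMap.range B) = r) (hS : S.Infinite)
    (hSr : ∀ t ∈ S, finrank K (LinearMap.range (A - t • B)) = r) :
    (∀ τ : K, finrank K (LinearMap.range (A - τ • B)) = r) ↔
      finrank K (⨅ t ∈ S, LinearMap.range (A - t • B) : Submodule K V) = r / 2 := by
  have hM := skew_sub_smul hA hB
  have hLW := orthogonal_iInf_range (S := S) hβ hrefl hA hB
  have hBLW := map_iSup_ker_le_iInf_range hβ hA hB hS hSr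
  have hWB := iInf_range_sub_smul_le A B hS fun t ht => ((hSr t ht).trans hBr.symm).le
  have hmap := map_iSup_ker_le_map (A := A) (B := B) (S := S)
  have hmap_eq := fun (τ : K) => map_iSup_ker_eq_map (A := A) (B := B) (S := S) (τ := τ)
  set W := ⨅ t ∈ S, LinearMap.range (A - t • B) with hW
  set L := ⨆ t ∈ S, LinearMap.ker (A - t • B) with hL
  have hker : LinearMap.ker B ≤ L := by
    have := LinearMap.BilinForm.orthogonal_le (B := β) hWB
    rwa [hLW, range_eq_orthogonal_ker hβ hB,
      LinearMap.BilinForm.orthogonal_orthogonal hβ hrefl] at this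
  have hdimL : finrank K L = finrank K V - finrank K W := by
    rw [← hLW, LinearMap.BilinForm.finrank_orthogonal hβ]
  have hdimW := Submodule.finrank_le W
  have hdimB := B.finrank_range_add_finrank_ker
  have hdimBL := finrank_map_add_finrank_ker hker
  have hdimle := Submodule.finrank_mono hBLW
  constructor
  · intro hreg
    rcases hBLW.eq_or_lt with heq | hlt
    · rw [heq] at hdimBL
      omega
    exfalso
    have hWL : ∀ w ∈ W, ∀ l ∈ L, β w l = 0 := fun w hw l hl => by
      rw [← hLW] at hl
      exact hl w hw
    have hAW : (W.comap B).map A ≤ W := by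
      rintro _ ⟨x, hx, rfl⟩
      rw [← LinearMap.BilinForm.orthogonal_orthogonal hβ hrefl W, hLW,
        LinearMap.BilinForm.mem_orthogonal_iff]
      intro l hl
      obtain ⟨l', hl', hll'⟩ : A l ∈ L.map B := hmap 0 ⟨l, hl, by simp⟩
      have h1 := hA l x
      rw [← hll', hB, hrefl _ _ (hWL _ hx _ hl')] at h1
      simpa using h1.symm
    obtain ⟨τ, x, hxL, hx⟩ := exists_sub_smul_mem_map hWB hker hlt (by simpa using hmap 0) hAW
    have hdimτ := (A - τ • B).finrank_range_add_finrank_ker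
    rw [hreg τ] at hdimτ
    have hmapτ : L.map (A - τ • B) = L.map B := by
      refine Submodule.eq_of_le_of_finrank_le (hmap τ) ?_
      have := finrank_le_finrank_map_add_finrank_ker (A - τ • B) L
      omega
    have hkerτ : LinearMap.ker (A - τ • B) ≤ L := by
      have h1 := ((A - τ • B).domRestrict L).finrank_range_add_finrank_ker
      rw [LinearMap.range_domRestrict, hmapτ, LinearMap.ker_domRestrict] at h1
      have h2 : ((LinearMap.ker (A - τ • B)).comap L.subtype).map L.subtype =
          LinearMap.ker (A - τ • B) := by
        refine Submodule.eq_of_le_of_finrank_le (Submodule.map_comap_le _ _) ?_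
        rw [Submodule.finrank_map_subtype_eq]
        omega
      rw [← h2]
      exact Submodule.map_subtype_le _ _
    rw [← hmapτ] at hx
    obtain ⟨l, hl, hlx⟩ := hx
    refine hxL ?_
    have : x - l ∈ L := hkerτ (by rw [LinearMap.mem_ker, map_sub, hlx, sub_self])
    simpa using L.add_mem this hl
  · intro hdim τ
    by_cases hτ : τ ∈ S
    · exact hSr τ hτ
    have heq : L.map B = W := Submodule.eq_of_le_of_finrank_le hBLW (by omega)
    rw [finrank_range_of_map_orthogonal hβ hrefl (hM τ)
      (by rw [hLW, hmap_eq τ hτ, heq] : (β.orthogonal W).map (A - τ • B) = W)]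
    omega

end SkewPencil

section Complexification

theorem finrank_eq_of_mem_iff_re_im {ι : Type*} [Fintype ι] (U : Submodule ℂ (ι → ℂ))
    (W : Submodule ℝ (ι → ℝ))
    (h : ∀ w, w ∈ U ↔ (fun i => (w i).re) ∈ W ∧ (fun i => (w i).im) ∈ W) :
    finrank ℂ U = finrank ℝ W := by
  let e : U ≃ₗ[ℝ] W × W :=
    { toFun := fun w => (⟨_, ((h w).1 w.2).1⟩, ⟨_, ((h w).1 w.2).2⟩)
      map_add' := fun _ _ => rfl
      map_smul' := fun c w => by ext i <;> simp
      invFun := fun p => ⟨fun i => ⟨p.1.1 i, p.2.1 i⟩, (h _).2 ⟨p.1.2, p.2.2⟩⟩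
      left_inv := fun _ => rfl
      right_inv := fun _ => rfl }
  have h1 := e.finrank_eq
  rw [finrank_real_of_complex, finrank_prod] at h1
  omega

variable {m n : Type*} [Fintype n]

theorem mem_range_map_ofReal_iff (M : Matrix m n ℝ) (w : m → ℂ) :
    w ∈ LinearMap.range (M.map Complex.ofReal).mulVecLin ↔
      (fun i => (w i).re) ∈ LinearMap.range M.mulVecLin ∧
        (fun i => (w i).im) ∈ LinearMap.range M.mulVecLin := by
  constructor
  · rintro ⟨x, rfl⟩
    refine ⟨⟨fun j => (x j).re, ?_⟩, ⟨fun j => (x j).im, ?_⟩⟩ <;> ext i <;>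
      simp [mulVec, dotProduct]
  · rintro ⟨⟨x, hx⟩, y, hy⟩
    refine ⟨fun j => ⟨x j, y j⟩, ?_⟩
    ext i
    apply Complex.ext
    · simpa [mulVec, dotProduct] using congrFun hx i
    · simpa [mulVec, dotProduct] using congrFun hy i

theorem rank_map_ofReal [Fintype m] (M : Matrix m n ℝ) : (M.map Complex.ofReal).rank = M.rank :=
  finrank_eq_of_mem_iff_re_im _ _ (mem_range_map_ofReal_iff M)

end Complexification

section MatrixPencil

theorem map_ofReal_sub_smul {n : Type*} (A B : Matrix n n ℝ) (t : ℝ) :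
    (A - t • B).map Complex.ofReal =
      A.map Complex.ofReal - (t : ℂ) • B.map Complex.ofReal := by
  ext i j
  simp

variable {n : Type*} [Fintype n]

theorem mulVecLin_sub_smul {K : Type*} [Field K] (A B : Matrix n n K) (t : K) :
    (A - t • B).mulVecLin = A.mulVecLin - t • B.mulVecLin := by
  ext x : 1
  simp

theorem nondegenerate_dotProductBilin {K : Type*} [Field K] :
    LinearMap.BilinForm.Nondegenerate (dotProductBilin K K : LinearMap.BilinForm K (n → K)) := by
  classical
  constructor
  · intro x hx
    exact dotProduct_eq_zero x hx
  · intro x hx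
    exact dotProduct_eq_zero x fun w => by rw [dotProduct_comm]; exact hx w

theorem isRefl_dotProductBilin {K : Type*} [Field K] :
    LinearMap.BilinForm.IsRefl (dotProductBilin K K : LinearMap.BilinForm K (n → K)) :=
  fun x y h => (dotProduct_comm y x).trans h

theorem dotProductBilin_mulVecLin_skew {K : Type*} [Field K] {M : Matrix n n K} (hM : Mᵀ = -M)
    (x y : n → K) :
    dotProductBilin K K (M.mulVecLin x) y = -dotProductBilin K K x (M.mulVecLin y) := by
  change (M *ᵥ x) ⬝ᵥ y = -(x ⬝ᵥ (M *ᵥ y))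
  rw [dotProduct_comm, dotProduct_mulVec, ← mulVec_transpose, hM, dotProduct_comm, neg_mulVec,
    dotProduct_neg]

theorem infinite_setOf_rank_sub_smul_eq (A B : Matrix n n ℝ)
    (hle : ∀ t : ℝ, (A - t • B).rank ≤ B.rank) :
    {t : ℝ | (A - t • B).rank = B.rank}.Infinite := by
  have hfin := (finite_setOf_finrank_range_add_smul_lt B.mulVecLin A.mulVecLin).union
    (Set.finite_singleton 0)
  refine (hfin.infinite_compl.image (f := fun s => -s⁻¹)
    (by intro x _ y _ h; simpa using h)).mono ?_
  rintro _ ⟨s, hs, rfl⟩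
  simp only [Set.mem_compl_iff, Set.mem_union, Set.mem_ofPred_eq, Set.mem_singleton_iff, not_or,
    not_lt] at hs
  obtain ⟨hs, hs0⟩ := hs
  refine (hle _).antisymm (hs.trans_eq ?_)
  have : B.mulVecLin + s • A.mulVecLin = s • (A - (-s⁻¹) • B).mulVecLin := by
    rw [mulVecLin_sub_smul, smul_sub, smul_smul]
    simp [hs0, add_comm]
  rw [this, LinearMap.range_smul _ _ hs0]
  rfl

theorem skew_matrix_pencil_criterion {A B : Matrix n n ℝ} (hA : Aᵀ = -A) (hB : Bᵀ = -B)
    (hle : ∀ t : ℝ, (A - t • B).rank ≤ B.rank) :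
    (∀ τ : ℂ, (A.map Complex.ofReal - τ • B.map Complex.ofReal).rank = B.rank) ↔
      finrank ℝ (⨅ t ∈ {t : ℝ | (A - t • B).rank = B.rank},
        LinearMap.range (A - t • B).mulVecLin : Submodule ℝ (n → ℝ)) = B.rank / 2 := by
  have hskew : ∀ {M : Matrix n n ℝ}, Mᵀ = -M →
      (M.map Complex.ofReal)ᵀ = -M.map Complex.ofReal := fun {M} hM => by
    rw [← transpose_map, hM]
    ext i j
    simp
  have hS := (infinite_setOf_rank_sub_smul_eq A B hle).image Complex.ofReal_injective.injOn
  have hsub (t : ℂ) : (A.map Complex.ofReal - t • B.map Complex.ofReal).mulVecLin =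
      (A.map Complex.ofReal).mulVecLin - t • (B.map Complex.ofReal).mulVecLin :=
    mulVecLin_sub_smul _ _ t
  have hcrit := skew_pencil_criterion (r := B.rank)
    (nondegenerate_dotProductBilin (K := ℂ) (n := n)) isRefl_dotProductBilin
    (dotProductBilin_mulVecLin_skew (hskew hA)) (dotProductBilin_mulVecLin_skew (hskew hB))
    (rank_map_ofReal B) hS (by
      rintro _ ⟨t, ht, rfl⟩
      rw [← hsub, ← map_ofReal_sub_smul]
      exact (rank_map_ofReal _).trans ht)
  rw [finrank_eq_of_mem_iff_re_im _ (⨅ t ∈ {t : ℝ | (A - t • B).rank = B.rank},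
        LinearMap.range (A - t • B).mulVecLin)] at hcrit
  · refine Iff.trans (forall_congr' fun τ => ?_) hcrit
    rw [Matrix.rank, hsub]
  · intro w
    simp only [Submodule.mem_iInf, Set.forall_mem_image, ← hsub, ← map_ofReal_sub_smul,
      mem_range_map_ofReal_iff]
    exact ⟨fun h => ⟨fun t ht => (h ht).1, fun t ht => (h ht).2⟩,
      fun h t ht => ⟨h.1 t ht, h.2 t ht⟩⟩

theorem rank_smul_add_smul_eq {K : Type*} [Field K] {A B : Matrix n n K} {r : ℕ}
    (h : ∀ τ : K, (A - τ • B).rank = r) (hB : B.rank = r) {u v : K}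
    (huv : u = 0 → v = 0 → False) : (u • B + v • A).rank = r := by
  rcases eq_or_ne v 0 with rfl | hv
  · have hu : u ≠ 0 := fun hu => huv hu rfl
    simpa [rank_smul_of_mem_nonZeroDivisors B (mem_nonZeroDivisors_of_ne_zero hu)] using hB
  · have : u • B + v • A = v • (A - (-u / v) • B) := by
      rw [smul_sub, smul_smul, mul_div_cancel₀ _ hv, neg_smul, sub_neg_eq_add, add_comm]
    rw [this, rank_smul_of_mem_nonZeroDivisors _ (mem_nonZeroDivisors_of_ne_zero hv), h]

theorem iInf_range_le_range_smul_add_smul {K : Type*} [Field K] {A B : Matrix n n K}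
    {r : ℕ} (hB : B.rank = r) (hS : {t : K | (A - t • B).rank = r}.Infinite) {u v : K}
    (huv : (u • B + v • A).rank = r) :
    ⨅ t ∈ {t : K | (A - t • B).rank = r}, LinearMap.range (A - t • B).mulVecLin ≤
      LinearMap.range (u • B + v • A).mulVecLin := by
  rcases eq_or_ne v 0 with rfl | hv
  · have hle : LinearMap.range (u • B + (0 : K) • A).mulVecLin ≤ LinearMap.range B.mulVecLin := by
      rintro _ ⟨x, rfl⟩
      exact ⟨u • x, by simp⟩
    rw [Submodule.eq_of_le_of_finrank_eq hle (huv.trans hB.symm)]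
    simp only [mulVecLin_sub_smul]
    refine iInf_range_sub_smul_le _ _ hS fun t ht => ?_
    rw [← mulVecLin_sub_smul]
    exact (Eq.trans ht hB.symm).le
  · have heq : u • B + v • A = v • (A - (-u / v) • B) := by
      rw [smul_sub, smul_smul, mul_div_cancel₀ _ hv, neg_smul, sub_neg_eq_add, add_comm]
    rw [heq, rank_smul_of_mem_nonZeroDivisors _ (mem_nonZeroDivisors_of_ne_zero hv)] at huv
    have hrange : LinearMap.range (v • (A - (-u / v) • B)).mulVecLin =
        LinearMap.range (A - (-u / v) • B).mulVecLin := by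
      rw [← LinearMap.range_smul (A - (-u / v) • B).mulVecLin v hv]
      congr 1
      ext x : 1
      simp only [mulVecLin_apply, smul_mulVec, LinearMap.smul_apply]
    rw [heq, hrange]
    exact iInf₂_le (f := fun t (_ : t ∈ {t : K | (A - t • B).rank = r}) =>
      LinearMap.range (A - t • B).mulVecLin) _ huv

end MatrixPencil

/-- pointwise Brailov completeness criterion: let `C1, C2` be real
skew-symmetric `N×N` matrices and `R0` the maximal rank of the real pencil. Then the complex
pencil `λ1·C1 + λ2·C2` has rank `R0` at every nonzero `(λ1,λ2) ∈ ℂ²` if and only if the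
intersection of the column spaces of the real pencil members of maximal rank `R0` has
dimension `R0/2`. -/
theorem brailov_completeness_criterion (N : ℕ) (C₁ C₂ : Matrix (Fin N) (Fin N) ℝ)
    (h₁ : C₁ᵀ = -C₁) (h₂ : C₂ᵀ = -C₂) (R0 : ℕ)
    (hR0 : IsGreatest {R : ℕ | ∃ l : ℝ × ℝ, (l.1 • C₁ + l.2 • C₂).rank = R} R0) :
    (∀ l : ℂ × ℂ, l ≠ 0 →
        (l.1 • C₁.map Complex.ofReal + l.2 • C₂.map Complex.ofReal).rank = R0) ↔
    Module.finrank ℝ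
      ((⨅ (l : ℝ × ℝ) (_ : (l.1 • C₁ + l.2 • C₂).rank = R0),
        LinearMap.range (l.1 • C₁ + l.2 • C₂).mulVecLin : Submodule ℝ (Fin N → ℝ))) =
      R0 / 2 := by
  obtain ⟨⟨l₀, hl₀⟩, hmax⟩ := hR0
  replace hmax : ∀ l : ℝ × ℝ, (l.1 • C₁ + l.2 • C₂).rank ≤ R0 := fun l => hmax ⟨l, rfl⟩
  obtain ⟨a, b, hd, hab⟩ : ∃ a b : ℝ, a ^ 2 + b ^ 2 ≠ 0 ∧ (a • C₁ + b • C₂).rank = R0 := by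
    by_cases h0 : l₀ = 0
    · refine ⟨1, 0, by norm_num, (hmax (1, 0)).antisymm ?_⟩
      rw [← hl₀, h0]
      simp
    · refine ⟨l₀.1, l₀.2, fun h => h0 ?_, hl₀⟩
      ext
      · exact pow_eq_zero_iff two_ne_zero |>.1 (by nlinarith [sq_nonneg l₀.1, sq_nonneg l₀.2])
      · exact pow_eq_zero_iff two_ne_zero |>.1 (by nlinarith [sq_nonneg l₀.1, sq_nonneg l₀.2])
  set B := a • C₁ + b • C₂ with hB
  set A := (-b) • C₁ + a • C₂ with hA
  have hAB : ∀ t : ℝ, A - t • B = (-b - t * a) • C₁ + (a - t * b) • C₂ := fun t => by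
    rw [hA, hB]; module
  have hABc : ∀ t : ℂ, A.map Complex.ofReal - t • B.map Complex.ofReal =
      (-b - t * a) • C₁.map Complex.ofReal + (a - t * b) • C₂.map Complex.ofReal := fun t => by
    ext i j
    simp [hA, hB]
    ring
  have hle : ∀ t : ℝ, (A - t • B).rank ≤ B.rank := fun t => by
    rw [hAB, hab]
    exact hmax (-b - t * a, a - t * b)
  have key := skew_matrix_pencil_criterion (A := A) (B := B)
    (by simp [hA, h₁, h₂]; abel) (by simp [hB, h₁, h₂]; abel) hle
  have hS := infinite_setOf_rank_sub_smul_eq A B hle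
  rw [hab] at key hS
  have hdc : (a : ℂ) ^ 2 + (b : ℂ) ^ 2 ≠ 0 := by exact_mod_cast hd
  have hleft : (∀ l : ℂ × ℂ, l ≠ 0 →
      (l.1 • C₁.map Complex.ofReal + l.2 • C₂.map Complex.ofReal).rank = R0) ↔
      ∀ τ : ℂ, (A.map Complex.ofReal - τ • B.map Complex.ofReal).rank = R0 := by
    constructor
    · intro h τ
      rw [hABc]
      refine h (-b - τ * a, a - τ * b) fun h0 => hdc ?_
      have e1 : (-b - τ * a : ℂ) = 0 := congrArg Prod.fst h0
      have e2 : (a - τ * b : ℂ) = 0 := congrArg Prod.snd h0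
      linear_combination (-b : ℂ) * e1 + a * e2
    · rintro h ⟨x, y⟩ hxy
      have hdecomp : x • C₁.map Complex.ofReal + y • C₂.map Complex.ofReal =
          ((x * a + y * b) / (a ^ 2 + b ^ 2)) • B.map Complex.ofReal +
            ((y * a - x * b) / (a ^ 2 + b ^ 2)) • A.map Complex.ofReal := by
        ext i j
        simp [hA, hB]
        field_simp
        ring
      rw [hdecomp]
      exact rank_smul_add_smul_eq h ((rank_map_ofReal B).trans hab) fun h1 h2 => hxy (by
        rw [div_eq_zero_iff, or_iff_left hdc] at h1 h2
        have hx : x * (a ^ 2 + b ^ 2) = 0 := by linear_combination a * h1 - b * h2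
        have hy : y * (a ^ 2 + b ^ 2) = 0 := by linear_combination b * h1 + a * h2
        rw [(mul_eq_zero.1 hx).resolve_right hdc, (mul_eq_zero.1 hy).resolve_right hdc]
        rfl)
  have hright : (⨅ (l : ℝ × ℝ) (_ : (l.1 • C₁ + l.2 • C₂).rank = R0),
      LinearMap.range (l.1 • C₁ + l.2 • C₂).mulVecLin : Submodule ℝ (Fin N → ℝ)) =
      ⨅ t ∈ {t : ℝ | (A - t • B).rank = R0}, LinearMap.range (A - t • B).mulVecLin := by
    apply le_antisymm
    · refine le_iInf₂ fun t ht => ?_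
      rw [Set.mem_ofPred_eq, hAB] at ht
      rw [hAB]
      exact iInf₂_le (f := fun (l : ℝ × ℝ) (_ : (l.1 • C₁ + l.2 • C₂).rank = R0) =>
        LinearMap.range (l.1 • C₁ + l.2 • C₂).mulVecLin) (-b - t * a, a - t * b) ht
    · refine le_iInf₂ fun ⟨x, y⟩ hl => ?_
      have hdecomp : x • C₁ + y • C₂ = ((x * a + y * b) / (a ^ 2 + b ^ 2)) • B +
            ((y * a - x * b) / (a ^ 2 + b ^ 2)) • A := by
        ext i j
        simp [hA, hB]
        field_simp
        ring
      dsimp only at hl ⊢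
      rw [hdecomp] at hl ⊢
      exact iInf_range_le_range_smul_add_smul hab hS hl
  rw [hleft, key, hright]

end
end

section
/- Involutivity of shifted invariants (Proposition 1.5 of the paper applied to the method of argument translation): Let L be a finite-dimensional real Lie algebra and let f, g : L* → ℝ be smooth functions satisfying the invariance condition x(⁅ξ, ∇f(x)⁆) = 0 for all x ∈ L* and all ξ ∈ L, and likewise for g. Then for every a ∈ L*, all t, s ∈ ℝ and every x ∈ L*, both x(⁅∇f(x + t·a), ∇g(x + s·a)⁆) = 0 and a(⁅∇f(x + t·a), ∇g(x + s·a)⁆) = 0; that is, all the translated functions x ↦ f(x + t·a) and x ↦ g(x + s·a) pairwise Poisson-commute with respect to every bracket of the argument-translation pencil. -/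
noncomputable section

variable {L E : Type*}

/-- The gradient `∇f(x) ∈ L` of a function `f` on the dual space of a finite-dimensional real
Lie algebra `L` (the dual being modeled by a normed space `E` via a linear equivalence
`p : E ≃ₗ[ℝ] L*`): the unique element of `L` with `Df(x)(ξ) = (p ξ)(∇f(x))` for all `ξ ∈ E`. -/
def lieGrad [LieRing L] [LieAlgebra ℝ L] [FiniteDimensional ℝ L]
    [NormedAddCommGroup E] [NormedSpace ℝ E]
    (p : E ≃ₗ[ℝ] Module.Dual ℝ L) (f : E → ℝ) (x : E) : L :=
  (Module.evalEquiv ℝ L).symm ((fderiv ℝ f x).toLinearMap.comp p.symm.toLinearMap)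

theorem apply_lieGrad [LieRing L] [LieAlgebra ℝ L] [FiniteDimensional ℝ L]
    [NormedAddCommGroup E] [NormedSpace ℝ E]
    (p : E ≃ₗ[ℝ] Module.Dual ℝ L) (f : E → ℝ) (x : E) (η : Module.Dual ℝ L) :
    η (lieGrad p f x) = fderiv ℝ f x (p.symm η) := by
  simp [lieGrad]

theorem continuous_apply_lieGrad [LieRing L] [LieAlgebra ℝ L] [FiniteDimensional ℝ L]
    [NormedAddCommGroup E] [NormedSpace ℝ E]
    (p : E ≃ₗ[ℝ] Module.Dual ℝ L) {f : E → ℝ} (hf : ContDiff ℝ 1 f) (η : Module.Dual ℝ L) :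
    Continuous fun x ↦ η (lieGrad p f x) := by
  simp only [apply_lieGrad]
  exact (hf.continuous_fderiv one_ne_zero).clm_apply continuous_const

/-- involutivity of shifted invariants: if `f, g : L* → ℝ` are smooth and
invariant, i.e. `x(⁅ξ, ∇f(x)⁆) = 0` for all `x ∈ L*`, `ξ ∈ L` (and likewise for `g`), then
for every `a ∈ L*`, all `t, s ∈ ℝ` and every `x ∈ L*` one has
`x(⁅∇f(x + t·a), ∇g(x + s·a)⁆) = 0` and `a(⁅∇f(x + t·a), ∇g(x + s·a)⁆) = 0`; that is, all
shifted invariants pairwise Poisson-commute with respect to every bracket of the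
argument-translation pencil. -/
theorem shifted_invariants_involutive [LieRing L] [LieAlgebra ℝ L] [FiniteDimensional ℝ L]
    [NormedAddCommGroup E] [NormedSpace ℝ E]
    (p : E ≃ₗ[ℝ] Module.Dual ℝ L) (f g : E → ℝ)
    (hf : ContDiff ℝ (⊤ : ℕ∞) f) (hg : ContDiff ℝ (⊤ : ℕ∞) g)
    (hfinv : ∀ x : E, ∀ ξ : L, p x ⁅ξ, lieGrad p f x⁆ = 0)
    (hginv : ∀ x : E, ∀ ξ : L, p x ⁅ξ, lieGrad p g x⁆ = 0) :
    ∀ a : E, ∀ t s : ℝ, ∀ x : E,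
      p x ⁅lieGrad p f (x + t • a), lieGrad p g (x + s • a)⁆ = 0 ∧
      p a ⁅lieGrad p f (x + t • a), lieGrad p g (x + s • a)⁆ = 0 := by
  intro a t s x
  have hf_shift (s : ℝ) :
      p x ⁅lieGrad p f (x + t • a), lieGrad p g (x + s • a)⁆ +
        t * p a ⁅lieGrad p f (x + t • a), lieGrad p g (x + s • a)⁆ = 0 := by
    have h := hfinv (x + t • a) (lieGrad p g (x + s • a))
    rw [← lie_skew, map_neg, neg_eq_zero] at h
    simpa using h
  have hg_shift (s : ℝ) :
      p x ⁅lieGrad p f (x + t • a), lieGrad p g (x + s • a)⁆ +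
        s * p a ⁅lieGrad p f (x + t • a), lieGrad p g (x + s • a)⁆ = 0 := by
    simpa using hginv (x + s • a) (lieGrad p f (x + t • a))
  have hcont : Continuous fun s : ℝ ↦
      p a ⁅lieGrad p f (x + t • a), lieGrad p g (x + s • a)⁆ :=
    (continuous_apply_lieGrad p (hg.of_le (by exact_mod_cast le_top))
      ((p a).comp (LieAlgebra.ad ℝ L (lieGrad p f (x + t • a))))).comp
      (show Continuous fun s : ℝ ↦ x + s • a by fun_prop)
  have ha_zero : (fun s : ℝ ↦ p a ⁅lieGrad p f (x + t • a), lieGrad p g (x + s • a)⁆) =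
      fun _ ↦ 0 := by
    refine hcont.ext_on (dense_compl_singleton t) continuous_const fun s hs ↦ ?_
    exact (mul_eq_zero.mp (by linear_combination hg_shift s - hf_shift s :
      (s - t) * p a ⁅lieGrad p f (x + t • a), lieGrad p g (x + s • a)⁆ = 0)).resolve_left
      (sub_ne_zero.mpr hs)
  have ha := congrFun ha_zero s
  exact ⟨by simpa [ha] using hf_shift s, ha⟩

end
end

section
/- Rank of the Jordan block pencil: Let m ≥ 1, μ ∈ ℂ, and let (J1, J2) be the Jordan block pair of dimension 2m with eigenvalue μ. Then for (λ1,λ2) ∈ ℂ² \ {(0,0)}, the matrix λ1·J1 + λ2·J2 has rank 2m if λ1 + λ2·μ ≠ 0, and has rank 2m − 2 if λ1 + λ2·μ = 0. In particular the rank of the pencil λ1·J1 + λ2·J2 is not constant on ℂ² \ {(0,0)}. -/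
open Matrix

noncomputable section

/-- The `m × m` upper-triangular Jordan block with eigenvalue `μ`. -/
def jordanA (m : ℕ) (μ : ℂ) : Matrix (Fin m) (Fin m) ℂ :=
  Matrix.of fun i j => if i = j then μ else if (j : ℕ) = (i : ℕ) + 1 then 1 else 0

/-- The first member `J1` of the Jordan block pair of dimension `2m`. -/
def jordanJ1 (m : ℕ) : Matrix (Fin m ⊕ Fin m) (Fin m ⊕ Fin m) ℂ :=
  Matrix.fromBlocks 0 (1 : Matrix (Fin m) (Fin m) ℂ) (-(1 : Matrix (Fin m) (Fin m) ℂ)ᵀ) 0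

/-- The second member `J2` of the Jordan block pair of dimension `2m` with eigenvalue `μ`. -/
def jordanJ2 (m : ℕ) (μ : ℂ) : Matrix (Fin m ⊕ Fin m) (Fin m ⊕ Fin m) ℂ :=
  Matrix.fromBlocks 0 (jordanA m μ) (-(jordanA m μ)ᵀ) 0

theorem finrank_submodule_prod {K V W : Type*} [Field K] [AddCommGroup V] [Module K V]
    [AddCommGroup W] [Module K W] [FiniteDimensional K V] [FiniteDimensional K W]
    (p : Submodule K V) (q : Submodule K W) :
    Module.finrank K (p.prod q) = Module.finrank K p + Module.finrank K q := by
  have h : (p.subtype.prodMap q.subtype).range = p.prod q := by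
    rw [LinearMap.range_prodMap, p.range_subtype, q.range_subtype]
  rw [← h, LinearMap.finrank_range_of_inj
    (p.subtype_injective.prodMap q.subtype_injective), Module.finrank_prod]

/-- The rank of a block anti-diagonal matrix is the sum of the ranks of its blocks. -/
theorem rank_fromBlocks_zero_diag {K m n o p : Type*} [Field K] [Fintype m] [Fintype n]
    [Fintype o] [Fintype p] (B : Matrix m n K) (C : Matrix o p K) :
    (fromBlocks 0 B C 0).rank = B.rank + C.rank := by
  have h : (fromBlocks 0 B C 0).mulVecLin.range.map
      (LinearEquiv.sumArrowLequivProdArrow m o K K).toLinearMap =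
      B.mulVecLin.range.prod C.mulVecLin.range := by
    ext ⟨u, v⟩
    simp only [Submodule.mem_map, LinearMap.mem_range, exists_exists_eq_and, Submodule.mem_prod,
      mulVecLin_apply, fromBlocks_mulVec, LinearEquiv.coe_coe]
    constructor
    · rintro ⟨x, hx⟩
      obtain ⟨rfl, rfl⟩ := Prod.mk.inj hx
      exact ⟨⟨x ∘ Sum.inr, by ext; simp⟩, ⟨x ∘ Sum.inl, by ext; simp⟩⟩
    · rintro ⟨⟨y, rfl⟩, ⟨x, rfl⟩⟩
      exact ⟨Sum.elim x y, by ext <;> simp⟩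
  rw [rank, ← LinearEquiv.finrank_map_eq (LinearEquiv.sumArrowLequivProdArrow m o K K), h,
    finrank_submodule_prod, rank, rank]

/-- The pencil is block anti-diagonal, so its rank is twice that of its upper right block. -/
theorem rank_jordan_pencil_eq_two_mul (m : ℕ) (μ a b : ℂ) :
    (a • jordanJ1 m + b • jordanJ2 m μ).rank =
      2 * (a • (1 : Matrix (Fin m) (Fin m) ℂ) + b • jordanA m μ).rank := by
  have h : a • jordanJ1 m + b • jordanJ2 m μ =
      fromBlocks 0 (a • (1 : Matrix (Fin m) (Fin m) ℂ) + b • jordanA m μ)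
        (-(a • (1 : Matrix (Fin m) (Fin m) ℂ) + b • jordanA m μ)ᵀ) 0 := by
    simp [jordanJ1, jordanJ2, fromBlocks_smul, fromBlocks_add, add_comm]
  rw [h, rank_fromBlocks_zero_diag, ← transpose_neg, rank_transpose, ← neg_one_smul ℂ,
    rank_smul_of_mem_nonZeroDivisors _ (by simp), two_mul]

theorem rank_smul_one_add_smul_jordanA_of_ne_zero (m : ℕ) (μ a b : ℂ) (h : a + b * μ ≠ 0) :
    (a • (1 : Matrix (Fin m) (Fin m) ℂ) + b • jordanA m μ).rank = m := by
  have hu : (a • (1 : Matrix (Fin m) (Fin m) ℂ) + b • jordanA m μ).IsUpperTriangular := by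
    intro i j hij
    have hji : (j : ℕ) < i := hij
    have h₁ : i ≠ j := by rintro rfl; omega
    have h₂ : (j : ℕ) ≠ i + 1 := by omega
    simp [jordanA, h₁, h₂]
  have hd : (a • (1 : Matrix (Fin m) (Fin m) ℂ) + b • jordanA m μ).det ≠ 0 := by
    rw [det_of_isUpperTriangular hu, Finset.prod_ne_zero_iff]
    intro i _
    simpa [jordanA] using h
  simpa using rank_of_det_ne_zero hd

theorem rank_smul_one_add_smul_jordanA_of_eq_zero (k : ℕ) (μ a b : ℂ) (hb : b ≠ 0)
    (h : a + b * μ = 0) :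
    (a • (1 : Matrix (Fin (k + 1)) (Fin (k + 1)) ℂ) + b • jordanA (k + 1) μ).rank = k := by
  set B := a • (1 : Matrix (Fin (k + 1)) (Fin (k + 1)) ℂ) + b • jordanA (k + 1) μ with hB
  apply le_antisymm
  · refine (B.rank_le_card_of_support_subset (Finset.univ.erase (Fin.last k)) ?_).trans (by simp)
    rw [Function.support_subset_iff']
    intro i hi
    obtain rfl : i = Fin.last k := by simpa using hi
    ext j
    rcases eq_or_ne (Fin.last k) j with rfl | hj
    · simpa [hB, jordanA] using h
    · have : (j : ℕ) ≠ k + 1 := by omega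
      simp [hB, jordanA, hj, this]
  · have hs : B.submatrix Fin.castSucc Fin.succ = b • (1 : Matrix (Fin k) (Fin k) ℂ) := by
      ext i j
      rcases eq_or_ne i j with rfl | hij
      · simp [hB, jordanA, (Fin.castSucc_lt_succ (i := i)).ne]
      · have h₁ : (j : ℕ) ≠ i := fun e => hij (Fin.ext e.symm)
        rcases eq_or_ne i.castSucc j.succ with e | e
        · simpa [hB, jordanA, e, hij] using h
        · simp [hB, jordanA, e, hij, h₁]
    have := B.rank_submatrix_le Fin.castSucc Fin.succ
    rwa [hs, rank_smul_of_mem_nonZeroDivisors _ (mem_nonZeroDivisors_of_ne_zero hb), rank_one,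
      Fintype.card_fin] at this

/-- rank of the Jordan block pencil: for nonzero `(λ1,λ2)` the rank of
`λ1·J1 + λ2·J2` is `2m` when `λ1 + λ2·μ ≠ 0` and `2m − 2` when `λ1 + λ2·μ = 0`; in particular
the rank is not constant on `ℂ² \ {0}`. -/
theorem jordan_pencil_rank (m : ℕ) (hm : 1 ≤ m) (μ : ℂ) (l : ℂ × ℂ) (hl : l ≠ 0) :
    ((l.1 + l.2 * μ ≠ 0 → (l.1 • jordanJ1 m + l.2 • jordanJ2 m μ).rank = 2 * m) ∧
      (l.1 + l.2 * μ = 0 → (l.1 • jordanJ1 m + l.2 • jordanJ2 m μ).rank = 2 * m - 2)) ∧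
    ∃ l₁ l₂ : ℂ × ℂ, l₁ ≠ 0 ∧ l₂ ≠ 0 ∧
      (l₁.1 • jordanJ1 m + l₁.2 • jordanJ2 m μ).rank ≠
        (l₂.1 • jordanJ1 m + l₂.2 • jordanJ2 m μ).rank := by
  have key : ∀ l : ℂ × ℂ, l ≠ 0 →
      (l.1 + l.2 * μ ≠ 0 → (l.1 • jordanJ1 m + l.2 • jordanJ2 m μ).rank = 2 * m) ∧
      (l.1 + l.2 * μ = 0 → (l.1 • jordanJ1 m + l.2 • jordanJ2 m μ).rank = 2 * m - 2) := by
    intro l hl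
    refine ⟨fun h => ?_, fun h => ?_⟩
    · rw [rank_jordan_pencil_eq_two_mul, rank_smul_one_add_smul_jordanA_of_ne_zero m μ _ _ h]
    · obtain ⟨k, rfl⟩ := Nat.exists_eq_add_of_le' hm
      have hb : l.2 ≠ 0 := fun h0 => hl (Prod.ext (by simpa [h0] using h) h0)
      rw [rank_jordan_pencil_eq_two_mul, rank_smul_one_add_smul_jordanA_of_eq_zero k μ _ _ hb h]
      omega
  refine ⟨key l hl, (1, 0), (-μ, 1), by simp, by simp, ?_⟩
  rw [(key (1, 0) (by simp)).1 (by simp), (key (-μ, 1) (by simp)).2 (by simp)]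
  omega

end
end
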